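/- arXiv:1405.5722 — 2 statements merged into one kernel-verified Lean document; each statement's English description precedes it below -/
import Mathlib

section
/- Let R be a Noetherian UFD and 0 → M' → M → M'' → 0 a short exact sequence of finitely generated torsion R-modules. Then the zeroth Fitting ideal satisfies Δ₀(M) = Δ₀(M')·Δ₀(M'') up to units, where Δ₀ denotes the gcd of the maximal minors of a square presentation matrix (equivalently, the order of the module). -/
/-- The set of all `k × k` minors of a matrix `A`. (Selections with repeated rows or
columns contribute `0`, which does not affect gcd considerations.) -/
def minorsSet {R : Type} [CommRing R] {m n : ℕ} (k : ℕ) (A : Matrix (Fin m) (Fin n) R) :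
    Set R :=
  Set.range (fun p : (Fin k → Fin m) × (Fin k → Fin n) => (A.submatrix p.1 p.2).det)

/-- `d` is a greatest common divisor of the set `S`. -/
def IsGCDOf {R : Type} [CommRing R] (d : R) (S : Set R) : Prop :=
  (∀ a ∈ S, d ∣ a) ∧ ∀ c : R, (∀ a ∈ S, c ∣ a) → c ∣ d

/-- The matrix `A` is a presentation matrix for the module `M` via the surjection `π`:
there is an exact sequence `R^m → R^n → M → 0` where the first map is `v ↦ v * A`. -/
def IsPresentation {R : Type} [CommRing R] {m n : ℕ} {M : Type} [AddCommGroup M]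
    [Module R M] (A : Matrix (Fin m) (Fin n) R) (π : (Fin n → R) →ₗ[R] M) : Prop :=
  Function.Surjective π ∧ LinearMap.ker π = LinearMap.range A.vecMulLinear

/-- The determinants of square matrices all of whose rows lie in `L`. -/
def rowDets {R ι : Type} [CommRing R] [Fintype ι] [DecidableEq ι] (L : Submodule R (ι → R)) :
    Set R :=
  {x | ∃ T : Matrix ι ι R, (∀ i, T i ∈ L) ∧ T.det = x}

/-- The rows of `B` lie in `L` and span it after inverting some element not divisible by `p`. -/
def IsLocalBasis {R ι : Type} [CommRing R] [Fintype ι] (p : R) (L : Submodule R (ι → R))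
    (B : Matrix ι ι R) : Prop :=
  (∀ i, B i ∈ L) ∧ ∃ s, ¬ p ∣ s ∧ ∀ v ∈ L, ∃ c : ι → R, s • v = Matrix.vecMul c B

section Presentation

variable {R : Type} [CommRing R] {m n : ℕ} {M : Type} [AddCommGroup M] [Module R M]
  {A : Matrix (Fin m) (Fin n) R} {π : (Fin n → R) →ₗ[R] M}

theorem IsPresentation.dvd_minors_iff (hA : IsPresentation A π) (c : R) :
    (∀ a ∈ minorsSet n A, c ∣ a) ↔ ∀ a ∈ rowDets (LinearMap.ker π), c ∣ a := by
  constructor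
  · rintro h _ ⟨T, hT, rfl⟩
    have hT' : ∀ i, ∃ w : Fin m → R, A.vecMulLinear w = T i := fun i => by
      have := hT i
      rwa [hA.2] at this
    choose C hC using hT'
    have hTC : T = fun i => ∑ j, C i j • A j := by
      funext i
      rw [← hC i, Matrix.vecMulLinear_apply, Matrix.vecMul_eq_sum]
    have hdet : T.det = Matrix.detRowAlternating.toMultilinearMap T := rfl
    rw [hdet, hTC, MultilinearMap.map_sum]
    refine Finset.dvd_sum fun r _ => ?_
    rw [MultilinearMap.map_smul_univ]
    exact Dvd.dvd.mul_left (h _ ⟨(r, id), rfl⟩) _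
  · rintro h _ ⟨⟨r, q⟩, rfl⟩
    have hq : A.submatrix r q =
        A.submatrix r id * (1 : Matrix (Fin n) (Fin n) R).submatrix id q := by
      ext
      simp [Matrix.mul_apply, Matrix.one_apply]
    change c ∣ (A.submatrix r q).det
    rw [hq, Matrix.det_mul]
    refine Dvd.dvd.mul_right (h _ ⟨_, fun i => ?_, rfl⟩) _
    rw [hA.2]
    exact ⟨Pi.single (r i) 1, by ext; simp⟩

theorem IsPresentation.isGCDOf_rowDets (hA : IsPresentation A π) {d : R}
    (hd : IsGCDOf d (minorsSet n A)) : IsGCDOf d (rowDets (LinearMap.ker π)) :=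
  ⟨(hA.dvd_minors_iff d).1 hd.1, fun c hc => hd.2 c ((hA.dvd_minors_iff c).2 hc)⟩

end Presentation

theorem IsLocalBasis.reindex {R ι κ : Type} [CommRing R] [Fintype ι] [Fintype κ] {p : R}
    {L : Submodule R (ι → R)} {B : Matrix ι ι R} (hB : IsLocalBasis p L B) (e : κ ≃ ι) :
    IsLocalBasis p (L.comap (LinearMap.funLeft R R e.symm)) (B.submatrix e e) := by
  obtain ⟨hBL, s, hs, hspan⟩ := hB
  refine ⟨fun i => ?_, s, hs, fun v hv => ?_⟩
  · rw [Submodule.mem_comap]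
    convert hBL (e i) using 1
    ext j
    simp [LinearMap.funLeft]
  · obtain ⟨c, hc⟩ := hspan _ hv
    refine ⟨c ∘ e, ?_⟩
    rw [Matrix.submatrix_vecMul_equiv]
    ext j
    have := congrFun hc (e j)
    simpa [LinearMap.funLeft, Function.comp_assoc] using this

theorem isLocalBasis_top_one {R κ : Type} [CommRing R] [Fintype κ] [DecidableEq κ] {p : R}
    (hp : Prime p) :
    IsLocalBasis p (⊤ : Submodule R (κ → R)) 1 :=
  ⟨fun _ => trivial, 1, hp.not_dvd_one, fun v _ => ⟨v, by simp⟩⟩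

section SumMap

variable {R ι κ M : Type} [CommRing R] [AddCommGroup M] [Module R M]

/-- The map on `ι ⊕ κ → R` that is `φ` on the first block and `ψ` on the second. -/
def sumMap (φ : (ι → R) →ₗ[R] M) (ψ : (κ → R) →ₗ[R] M) : (ι ⊕ κ → R) →ₗ[R] M :=
  φ ∘ₗ LinearMap.funLeft R R Sum.inl + ψ ∘ₗ LinearMap.funLeft R R Sum.inr

theorem sumMap_apply (φ : (ι → R) →ₗ[R] M) (ψ : (κ → R) →ₗ[R] M) (v : ι ⊕ κ → R) :
    sumMap φ ψ v = φ (v ∘ Sum.inl) + ψ (v ∘ Sum.inr) := rfl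

theorem IsLocalBasis.exists_fromBlocks [Fintype ι] [Fintype κ] {p : R} (hp : Prime p)
    {M' M'' : Type} [AddCommGroup M'] [Module R M'] [AddCommGroup M''] [Module R M'']
    {f : M' →ₗ[R] M} {g : M →ₗ[R] M''}
    (hf : Function.Injective f) (hfg : Function.Exact f g)
    {π' : (ι → R) →ₗ[R] M'} (hπ' : Function.Surjective π') {ρ : (κ → R) →ₗ[R] M}
    {B' : Matrix ι ι R} {B'' : Matrix κ κ R} (hB' : IsLocalBasis p (LinearMap.ker π') B')
    (hB'' : IsLocalBasis p (LinearMap.ker (g ∘ₗ ρ)) B'') :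
    ∃ X, IsLocalBasis p (LinearMap.ker (sumMap (f ∘ₗ π') ρ)) (Matrix.fromBlocks B' 0 X B'') := by
  obtain ⟨hL', s', hs', hspan'⟩ := hB'
  obtain ⟨hL'', s'', hs'', hspan''⟩ := hB''
  have hX : ∀ j, ∃ x, f (π' x) = -ρ (B'' j) := fun j => by
    obtain ⟨y, hy⟩ := (hfg (-ρ (B'' j))).1 (by
      rw [map_neg, neg_eq_zero]
      exact hL'' j)
    obtain ⟨x, rfl⟩ := hπ' y
    exact ⟨x, hy⟩
  choose X hX using hX
  have hrow : ∀ i, sumMap (f ∘ₗ π') ρ (Matrix.fromBlocks B' 0 (Matrix.of X) B'' i) = 0 := by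
    rintro (i | j)
    · change f (π' (B' i)) + ρ 0 = 0
      rw [show π' (B' i) = 0 from hL' i, map_zero, map_zero, add_zero]
    · change f (π' (X j)) + ρ (B'' j) = 0
      rw [hX, neg_add_cancel]
  refine ⟨Matrix.of X, hrow, s' * s'', fun h => (hp.dvd_or_dvd h).elim hs' hs'', fun v hv => ?_⟩
  rw [LinearMap.mem_ker, sumMap_apply] at hv
  obtain ⟨c'', hc''⟩ := hspan'' (v ∘ Sum.inr) (by
    have := congrArg g hv
    simpa [hfg.apply_apply_eq_zero] using this)
  have hcomb : f (π' (Matrix.vecMul c'' (Matrix.of X))) + ρ (Matrix.vecMul c'' B'') = 0 := by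
    simp only [Matrix.vecMul_eq_sum, map_sum, map_smul, ← Finset.sum_add_distrib, ← smul_add]
    refine Finset.sum_eq_zero fun j _ => ?_
    rw [show Matrix.of X j = X j from rfl, hX, neg_add_cancel, smul_zero]
  obtain ⟨c', hc'⟩ := hspan' (s'' • (v ∘ Sum.inl) - Matrix.vecMul c'' (Matrix.of X)) (by
    rw [LinearMap.mem_ker]
    apply hf
    have h1 : s'' • f (π' (v ∘ Sum.inl)) + ρ (Matrix.vecMul c'' B'') = 0 := by
      rw [← hc'', map_smul, ← smul_add]
      exact (congrArg _ hv).trans (smul_zero _)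
    rw [map_zero, map_sub, map_sub, map_smul, map_smul, sub_eq_zero]
    exact add_right_cancel (h1.trans hcomb.symm))
  refine ⟨Sum.elim c' (s' • c''), ?_⟩
  rw [Matrix.vecMul_fromBlocks]
  funext i
  rcases i with i | i
  · have := congrFun hc' i
    simp only [Pi.smul_apply, Pi.sub_apply, smul_eq_mul, Function.comp_apply] at this
    simp [Matrix.smul_vecMul, ← this]
    ring
  · have := congrFun hc'' i
    simp only [Pi.smul_apply, smul_eq_mul, Function.comp_apply] at this
    simp [Matrix.smul_vecMul, ← this]
    ring

theorem IsLocalBasis.exists_sumMap [Fintype ι] [DecidableEq ι] [Fintype κ] [DecidableEq κ]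
    {p : R} (hp : Prime p) {φ : (ι → R) →ₗ[R] M}
    (hφ : Function.Surjective φ) (ψ : (κ → R) →ₗ[R] M) {B : Matrix ι ι R}
    (hB : IsLocalBasis p (LinearMap.ker φ) B) :
    ∃ Q, IsLocalBasis p (LinearMap.ker (sumMap φ ψ)) Q ∧ Q.det = B.det := by
  have hexact : Function.Exact (LinearMap.id : M →ₗ[R] M) (0 : M →ₗ[R] PUnit) := fun y => by simp
  obtain ⟨X, hX⟩ := hB.exists_fromBlocks hp (f := LinearMap.id) (g := (0 : M →ₗ[R] PUnit))
    Function.injective_id hexact hφ (ρ := ψ) (B'' := 1) (by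
      simpa using isLocalBasis_top_one hp)
  exact ⟨_, hX, by simp⟩

end SumMap

section LocalBasis

variable {R : Type} [CommRing R] [IsDomain R]
  {ι κ : Type} [Fintype ι] [DecidableEq ι] [Fintype κ] [DecidableEq κ] {p : R}

theorem IsGCDOf.ne_zero_of_isTorsion {M : Type} [AddCommGroup M] [Module R M]
    [Module.Finite R M] (hM : Module.IsTorsion R M) {π : (ι → R) →ₗ[R] M} {d : R}
    (hd : IsGCDOf d (rowDets (LinearMap.ker π))) : d ≠ 0 := by
  obtain ⟨r, hr, hr0⟩ := Submodule.annihilator_top_inter_nonZeroDivisors hM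
  rintro rfl
  have hdvd := hd.1 (r • (1 : Matrix ι ι R)).det ⟨_, fun i => ?_, rfl⟩
  · rw [zero_dvd_iff, Matrix.det_smul, Matrix.det_one, mul_one] at hdvd
    exact nonZeroDivisors.ne_zero hr0 (eq_zero_of_pow_eq_zero hdvd)
  · change π (r • (1 : Matrix ι ι R) i) = 0
    rw [map_smul]
    exact Submodule.mem_annihilator.1 hr _ trivial

theorem IsLocalBasis.pow_dvd_det_of_pow_dvd (hp : Prime p) {L : Submodule R (ι → R)}
    {B T : Matrix ι ι R} (hB : IsLocalBasis p L B) (hT : ∀ i, T i ∈ L) {k : ℕ}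
    (hk : p ^ k ∣ B.det) : p ^ k ∣ T.det := by
  obtain ⟨-, s, hs, hspan⟩ := hB
  choose C hC using fun i => hspan (T i) (hT i)
  have hmul : s • T = Matrix.of C * B := by
    ext i j
    exact congrFun (hC i) j
  have hdet := congrArg Matrix.det hmul
  rw [Matrix.det_smul, Matrix.det_mul] at hdet
  refine hp.pow_dvd_of_dvd_mul_left (a := s ^ Fintype.card ι) k
    (fun h => hs (hp.dvd_of_dvd_pow h)) ?_
  rw [hdet]
  exact hk.mul_left _

theorem IsLocalBasis.pow_dvd_det_iff (hp : Prime p) {L : Submodule R (ι → R)}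
    {B C : Matrix ι ι R} (hB : IsLocalBasis p L B) (hC : IsLocalBasis p L C) (k : ℕ) :
    p ^ k ∣ B.det ↔ p ^ k ∣ C.det :=
  ⟨hB.pow_dvd_det_of_pow_dvd hp hC.1, hC.pow_dvd_det_of_pow_dvd hp hB.1⟩

theorem IsLocalBasis.pow_dvd_gcd_iff (hp : Prime p) {L : Submodule R (ι → R)}
    {B : Matrix ι ι R} (hB : IsLocalBasis p L B) {d : R} (hd : IsGCDOf d (rowDets L)) (k : ℕ) :
    p ^ k ∣ d ↔ p ^ k ∣ B.det := by
  refine ⟨fun h => h.trans (hd.1 _ ⟨B, hB.1, rfl⟩), fun h => hd.2 _ ?_⟩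
  rintro _ ⟨T, hT, rfl⟩
  exact hB.pow_dvd_det_of_pow_dvd hp hT h

theorem IsGCDOf.exists_isLocalBasis [IsNoetherianRing R] (hp : Prime p)
    {L : Submodule R (ι → R)} {d : R} (hd : IsGCDOf d (rowDets L)) (hd0 : d ≠ 0) :
    ∃ B, IsLocalBasis p L B := by
  have hfin : FiniteMultiplicity p d := FiniteMultiplicity.of_prime_left hp hd0
  set k := multiplicity p d
  have hk : p ^ k ∣ d := pow_multiplicity_dvd p d
  obtain ⟨B, hB, hBk⟩ : ∃ B : Matrix ι ι R, (∀ i, B i ∈ L) ∧ ¬ p ^ (k + 1) ∣ B.det := by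
    by_contra! h
    refine hfin.not_pow_dvd_of_multiplicity_lt (Nat.lt_succ_self k) (hd.2 _ ?_)
    rintro _ ⟨T, hT, rfl⟩
    exact h T hT
  obtain ⟨s, hs⟩ := hk.trans (hd.1 _ ⟨B, hB, rfl⟩)
  refine ⟨B, hB, s, fun ⟨t, ht⟩ => hBk ⟨t, by rw [hs, ht]; ring⟩, fun v hv => ?_⟩
  have hcramer : ∀ i, p ^ k ∣ Matrix.cramer B.transpose v i := fun i => by
    rw [Matrix.cramer_transpose_apply]
    refine hk.trans (hd.1 _ ⟨_, fun j => ?_, rfl⟩)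
    by_cases h : j = i
    · subst h
      simpa [Matrix.updateRow_self] using hv
    · simpa [Matrix.updateRow_ne h] using hB j
  choose c hc using hcramer
  refine ⟨c, ?_⟩
  have hv := Matrix.mulVec_cramer B.transpose v
  rw [Matrix.mulVec_transpose, Matrix.det_transpose, hs,
    show Matrix.cramer B.transpose v = p ^ k • c from funext hc, Matrix.smul_vecMul,
    mul_smul] at hv
  exact (smul_right_injective _ (pow_ne_zero k hp.ne_zero) hv).symm

theorem IsLocalBasis.pow_dvd_det_iff_of_surjective (hp : Prime p) {M : Type} [AddCommGroup M]
    [Module R M] {φ : (ι → R) →ₗ[R] M}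
    (hφ : Function.Surjective φ) {ψ : (κ → R) →ₗ[R] M} (hψ : Function.Surjective ψ)
    {B : Matrix ι ι R} {C : Matrix κ κ R} (hB : IsLocalBasis p (LinearMap.ker φ) B)
    (hC : IsLocalBasis p (LinearMap.ker ψ) C) (k : ℕ) : p ^ k ∣ B.det ↔ p ^ k ∣ C.det := by
  obtain ⟨P, hP, hPdet⟩ := hB.exists_sumMap hp hφ ψ
  obtain ⟨Q, hQ, hQdet⟩ := hC.exists_sumMap hp hψ φ
  have hQ' := hQ.reindex (Equiv.sumComm ι κ)
  have hker : (LinearMap.ker (sumMap ψ φ)).comap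
      (LinearMap.funLeft R R (Equiv.sumComm ι κ).symm) = LinearMap.ker (sumMap φ ψ) := by
    ext v
    simp only [Submodule.mem_comap, LinearMap.mem_ker, sumMap_apply]
    rw [add_comm]
    rfl
  rw [hker] at hQ'
  rw [← hPdet, ← hQdet, hP.pow_dvd_det_iff hp hQ', Matrix.det_submatrix_equiv_self]

end LocalBasis

/-- Let `R` be a Noetherian UFD and `0 → M' → M → M'' → 0` a short exact
sequence of finitely generated torsion `R`-modules. Then the zeroth Alexander polynomials
(gcds of maximal minors of presentation matrices, i.e. orders of the modules) satisfy
`Δ₀(M) = Δ₀(M')·Δ₀(M'')` up to units. -/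
theorem delta_zero_multiplicative {R : Type} [CommRing R] [IsDomain R] [IsNoetherianRing R]
    [UniqueFactorizationMonoid R]
    {M' M M'' : Type} [AddCommGroup M'] [Module R M'] [AddCommGroup M] [Module R M]
    [AddCommGroup M''] [Module R M'']
    [Module.Finite R M'] [Module.Finite R M] [Module.Finite R M'']
    (hT' : Module.IsTorsion R M') (hT : Module.IsTorsion R M)
    (hT'' : Module.IsTorsion R M'')
    (f : M' →ₗ[R] M) (g : M →ₗ[R] M'')
    (hf : Function.Injective f) (hg : Function.Surjective g) (hfg : Function.Exact f g)
    {m' n' m n m'' n'' : ℕ}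
    (A' : Matrix (Fin m') (Fin n') R) (π' : (Fin n' → R) →ₗ[R] M')
    (hA' : IsPresentation A' π')
    (A : Matrix (Fin m) (Fin n) R) (π : (Fin n → R) →ₗ[R] M)
    (hA : IsPresentation A π)
    (A'' : Matrix (Fin m'') (Fin n'') R) (π'' : (Fin n'' → R) →ₗ[R] M'')
    (hA'' : IsPresentation A'' π'')
    (d' d d'' : R)
    (hd' : IsGCDOf d' (minorsSet n' A')) (hd : IsGCDOf d (minorsSet n A))
    (hd'' : IsGCDOf d'' (minorsSet n'' A'')) :
    Associated d (d' * d'') := by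
  replace hd' := hA'.isGCDOf_rowDets hd'
  replace hd := hA.isGCDOf_rowDets hd
  replace hd'' := hA''.isGCDOf_rowDets hd''
  have h0' := hd'.ne_zero_of_isTorsion hT'
  have h0 := hd.ne_zero_of_isTorsion hT
  have h0'' := hd''.ne_zero_of_isTorsion hT''
  have key : ∀ p : R, Prime p → emultiplicity p d = emultiplicity p (d' * d'') := by
    intro p hp
    obtain ⟨B', hB'⟩ := hd'.exists_isLocalBasis hp h0'
    obtain ⟨B, hB⟩ := hd.exists_isLocalBasis hp h0
    obtain ⟨B'', hB''⟩ := hd''.exists_isLocalBasis hp h0''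
    obtain ⟨ρ, hρ⟩ := Module.projective_lifting_property g π'' hg
    obtain ⟨X, hX⟩ := hB'.exists_fromBlocks hp hf hfg hA'.1 (ρ := ρ) (hρ.symm ▸ hB'')
    have hsurj : Function.Surjective (sumMap (f ∘ₗ π') ρ) := fun y => by
      obtain ⟨w, hw⟩ := hA''.1 (g y)
      obtain ⟨x, hx⟩ := (hfg (y - ρ w)).1 (by
        rw [map_sub, ← hw, ← hρ, LinearMap.comp_apply, sub_self])
      obtain ⟨u, rfl⟩ := hA'.1 x
      refine ⟨Sum.elim u w, ?_⟩
      rw [sumMap_apply, Sum.elim_comp_inl, Sum.elim_comp_inr, LinearMap.comp_apply, hx,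
        sub_add_cancel]
    have e' := emultiplicity_eq_emultiplicity_iff.2 (hB'.pow_dvd_gcd_iff hp hd')
    have e := emultiplicity_eq_emultiplicity_iff.2 (hB.pow_dvd_gcd_iff hp hd)
    have e'' := emultiplicity_eq_emultiplicity_iff.2 (hB''.pow_dvd_gcd_iff hp hd'')
    have eX := emultiplicity_eq_emultiplicity_iff.2
      (hB.pow_dvd_det_iff_of_surjective hp hA.1 hsurj hX)
    rw [e, eX, Matrix.det_fromBlocks_zero₁₂, emultiplicity_mul hp, emultiplicity_mul hp, e', e'']
  exact associated_of_dvd_dvd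
    ((UniqueFactorizationMonoid.dvd_iff_emultiplicity_le h0).2 fun p hp => (key p hp).le)
    ((UniqueFactorizationMonoid.dvd_iff_emultiplicity_le (mul_ne_zero h0' h0'')).2
      fun p hp => (key p hp).ge)
end

section
/- Let R be a Noetherian UFD with field of fractions K, and M a finitely generated R-module with d = dim_K (M ⊗_R K). Then Δ_d(M) = Δ₀(tM) up to units, where tM is the torsion submodule of M and Δ_k denotes the k-th Alexander polynomial (gcd of the (n−k)×(n−k) minors of a presentation matrix). -/
open TensorProduct

open Matrix

/-- The minors formed from the first `b` columns of a square matrix generate an ideal containing its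
determinant. -/
theorem dvd_det_of_dvd_castAdd_minors {R : Type*} [CommRing R] {c : R} {b : ℕ} (a : ℕ)
    (N : Matrix (Fin (b + a)) (Fin (b + a)) R)
    (h : ∀ s : Fin b → Fin (b + a), c ∣ (N.submatrix s (Fin.castAdd a)).det) : c ∣ N.det := by
  induction a with
  | zero => exact h id
  | succ a ih =>
    rw [det_succ_column (n := b + a) N (Fin.last _)]
    refine Finset.dvd_sum fun i _ => Dvd.dvd.mul_left (ih _ fun s => ?_) _
    rw [submatrix_submatrix, Fin.succAbove_last]
    exact h _

theorem dvd_det_of_mem_range_vecMulLinear {R : Type*} [CommRing R] {c : R} {m k : ℕ}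
    (Z : Matrix (Fin m) (Fin k) R) (h : ∀ s : Fin k → Fin m, c ∣ (Z.submatrix s id).det)
    (Q : Matrix (Fin k) (Fin k) R) (hQ : ∀ i, Q i ∈ LinearMap.range Z.vecMulLinear) :
    c ∣ Q.det := by
  choose Y hY using hQ
  have hQ' : Q = fun i => ∑ j, Y i j • Z j := by
    ext i l
    simp [← hY, vecMul, dotProduct, Finset.sum_apply]
  change c ∣ detRowAlternating.toMultilinearMap Q
  rw [hQ', MultilinearMap.map_sum]
  refine Finset.dvd_sum fun s _ => ?_
  rw [MultilinearMap.map_smul_univ]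
  exact Dvd.dvd.mul_left (h s) _

/-- If two finite families in a module generate the same submodule up to the scalars `ε` and `δ`,
then a common divisor of the determinants of relation matrices of one family divides, up to a power
of `δ * ε`, the determinants of relation matrices of the other. -/
theorem dvd_det_of_relations {R T : Type*} [CommRing R] [AddCommGroup T] [Module R T]
    {a b : ℕ} {x : Fin a → T} {y : Fin b → T} {ε δ c : R}
    {U : Matrix (Fin a) (Fin b) R} {V : Matrix (Fin b) (Fin a) R}
    (hU : ∀ i, ε • x i = ∑ j, U i j • y j) (hV : ∀ i, δ • y i = ∑ j, V i j • x j)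
    (h : ∀ Q : Matrix (Fin b) (Fin b) R, (∀ i, ∑ j, Q i j • y j = 0) → c ∣ Q.det)
    (P : Matrix (Fin a) (Fin a) R) (hP : ∀ i, ∑ j, P i j • x j = 0) :
    c ∣ (δ * ε) ^ b * P.det := by
  have key : ∀ {k : ℕ} (W : Matrix (Fin k) (Fin a) R) (i : Fin k),
      ∑ j, (W * U) i j • y j = ε • ∑ j, W i j • x j := by
    intro k W i
    simp_rw [mul_apply, Finset.sum_smul, Finset.smul_sum, mul_smul]
    rw [Finset.sum_comm]
    refine Finset.sum_congr rfl fun j _ => ?_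
    rw [smul_comm, hU, Finset.smul_sum]
  let N := fromBlocks (V * U - (δ * ε) • (1 : Matrix (Fin b) (Fin b) R)) V (P * U) P
  have hN : N = fromBlocks (-(δ • (1 : Matrix (Fin b) (Fin b) R))) V 0 P *
      fromBlocks (ε • (1 : Matrix (Fin b) (Fin b) R)) 0 U 1 := by
    simp [N, fromBlocks_multiply, smul_smul, sub_eq_neg_add, mul_comm]
  have hdet : N.det = (-1) ^ b * ((δ * ε) ^ b * P.det) := by
    rw [hN, det_mul, det_fromBlocks_zero₂₁, det_fromBlocks_zero₁₂, ← neg_smul]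
    simp only [det_smul, det_one, Fintype.card_fin]
    rw [neg_pow, mul_pow]; ring
  have hrel : ∀ i, ∑ j, N i (Sum.inl j) • y j = 0 := by
    rintro (i | i)
    · simp only [N, fromBlocks_apply₁₁, Matrix.sub_apply, sub_smul, Finset.sum_sub_distrib, key,
        ← hV, Matrix.smul_apply, Matrix.one_apply]
      simp [smul_smul, mul_comm]
    · simp only [N, fromBlocks_apply₂₁, key, hP, smul_zero]
  have hc : c ∣ N.det := by
    rw [← det_reindex_self finSumFinEquiv]
    refine dvd_det_of_dvd_castAdd_minors a _ fun s => h _ fun i => ?_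
    simpa using hrel (finSumFinEquiv.symm (s i))
  rw [hdet] at hc
  exact ((isUnit_one.neg.pow b).dvd_mul_left).1 hc

theorem exists_minor_ne_zero_of_linearIndependent {R : Type*} [CommRing R] [Nontrivial R]
    {r n : ℕ} (E : Matrix (Fin r) (Fin n) R) (hE : LinearIndependent R E) :
    ∃ J : Fin r → Fin n, (E.submatrix id J).det ≠ 0 := by
  induction r with
  | zero => exact ⟨Fin.elim0, by simp⟩
  | succ r ih =>
    obtain ⟨J, hJ⟩ := ih (E.submatrix Fin.succ id) (hE.comp _ (Fin.succ_injective r))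
    by_contra! h
    refine hJ ?_
    have := Fintype.linearIndependent_iff.1 hE
      (fun i => (-1) ^ (i : ℕ) * (E.submatrix i.succAbove J).det) ?_ 0
    · simpa [Fin.succAbove_zero] using this
    · ext j
      have hj := h (Fin.cons j J)
      rw [det_succ_column_zero] at hj
      simp only [Finset.sum_apply, Pi.smul_apply, smul_eq_mul, Pi.zero_apply]
      rw [← hj]
      refine Finset.sum_congr rfl fun i _ => ?_
      simp only [submatrix_submatrix, submatrix_apply, id, Fin.cons_zero]
      rw [mul_right_comm]
      congr 1

/-- A saturated submodule of rank `r` of a free module contains `r` vectors with a maximal minor not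
divisible by a given prime. -/
theorem exists_minor_not_dvd_of_saturated {R : Type*} [CommRing R] [IsDomain R]
    [IsNoetherianRing R] {r n : ℕ} {N : Submodule R (Fin n → R)}
    (hsat : ∀ (a : R) (w : Fin n → R), a ≠ 0 → a • w ∈ N → w ∈ N)
    {E₀ : Matrix (Fin r) (Fin n) R} (hE₀ : ∀ i, E₀ i ∈ N) {J₀ : Fin r → Fin n}
    (hJ₀ : (E₀.submatrix id J₀).det ≠ 0) {p : R} (hp : Prime p) :
    ∃ (E : Matrix (Fin r) (Fin n) R) (J : Fin r → Fin n),
      (∀ i, E i ∈ N) ∧ ¬ p ∣ (E.submatrix id J).det := by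
  obtain ⟨k, hk⟩ := FiniteMultiplicity.of_prime_left hp hJ₀
  clear hJ₀
  induction k generalizing E₀ J₀ with
  | zero => exact ⟨E₀, J₀, hE₀, by simpa using hk⟩
  | succ k ih =>
    by_contra! hall
    have : (Ideal.span {p}).IsPrime := (Ideal.span_singleton_prime hp.ne_zero).2 hp
    let q := Ideal.Quotient.mk (Ideal.span {p})
    have hq : ∀ t, q t = 0 ↔ p ∣ t := fun t => by
      rw [Ideal.Quotient.eq_zero_iff_mem, Ideal.mem_span_singleton]
    have hdep : ¬ LinearIndependent (R ⧸ Ideal.span {p}) (E₀.map q) := fun hli => by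
      obtain ⟨J, hJ⟩ := exists_minor_ne_zero_of_linearIndependent _ hli
      refine hJ ?_
      have := (hq _).2 (hall E₀ J hE₀)
      rwa [RingHom.map_det] at this
    obtain ⟨x', hx', i, hi⟩ := Fintype.not_linearIndependent_iff.1 hdep
    choose x hx using fun i => Ideal.Quotient.mk_surjective (x' i)
    have hdiv : ∀ j, p ∣ (∑ i, x i • E₀ i) j := fun j => by
      rw [← hq]
      have := congrFun hx' j
      simpa [Finset.sum_apply, q, hx] using this
    choose w hw using hdiv
    have hpw : ∑ i, x i • E₀ i = p • w := funext hw
    have hwN : w ∈ N := hsat p w hp.ne_zero (hpw ▸ N.sum_mem fun i _ => N.smul_mem _ (hE₀ i))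
    have hpi : ¬ p ∣ x i := fun h => hi (by rw [← hx]; exact (hq _).2 h)
    have hdet : p * ((E₀.updateRow i w).submatrix id J₀).det =
        x i * (E₀.submatrix id J₀).det := by
      have h1 : (E₀.updateRow i w).submatrix id J₀ =
          (E₀.submatrix id J₀).updateRow i (w ∘ J₀) := by
        ext a j
        by_cases h : a = i <;> simp [updateRow_apply, h]
      have h2 : p • (w ∘ J₀) = ∑ i, x i • (E₀.submatrix id J₀) i := by
        ext j
        simpa [Finset.sum_apply] using (hw (J₀ j)).symm
      rw [h1, ← det_updateRow_smul, h2, det_updateRow_sum, smul_eq_mul]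
    obtain ⟨E, J, hE, hJ⟩ := ih (E₀ := E₀.updateRow i w) (J₀ := J₀) (fun a => by
      by_cases h : a = i
      · subst h; simpa using hwN
      · rw [updateRow_ne h]; exact hE₀ a) (fun hd => hk (by
        refine hp.pow_dvd_of_dvd_mul_left _ hpi ?_
        rw [← hdet, pow_succ']
        exact mul_dvd_mul_left p hd))
    exact hJ (hall E J hE)

/-- Cramer's rule: a nonzero maximal minor of `r` vectors in a submodule of rank at most `r` is a
common denominator for the coordinates of all elements with respect to these vectors. -/
theorem exists_det_smul_eq_vecMul {R : Type*} [CommRing R] [IsDomain R] {r n : ℕ}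
    {N : Submodule R (Fin n → R)} (hN : Module.rank R N ≤ r)
    {E : Matrix (Fin r) (Fin n) R} (hE : ∀ i, E i ∈ N) {J : Fin r → Fin n}
    (hJ : (E.submatrix id J).det ≠ 0) {w : Fin n → R} (hw : w ∈ N) :
    ∃ c : Fin r → R, (E.submatrix id J).det • w = c ᵥ* E := by
  set G := E.submatrix id J
  have hsub : ∀ (c : Fin r → R), (c ᵥ* E) ∘ J = c ᵥ* G := fun c => rfl
  refine ⟨(w ∘ J) ᵥ* G.adjugate, ?_⟩
  set c := (w ∘ J) ᵥ* G.adjugate with hc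
  have hcG : c ᵥ* G = G.det • (w ∘ J) := by
    rw [hc, vecMul_vecMul, adjugate_mul, vecMul_smul, vecMul_one]
  have hEmem : ∀ c : Fin r → R, c ᵥ* E ∈ N := fun c => by
    rw [vecMul_eq_sum]
    exact N.sum_mem fun i _ => N.smul_mem _ (hE i)
  let v : N := ⟨G.det • w - c ᵥ* E, N.sub_mem (N.smul_mem _ hw) (hEmem c)⟩
  have hvJ : (v : Fin n → R) ∘ J = 0 := by
    change G.det • (w ∘ J) - (c ᵥ* E) ∘ J = 0
    rw [hsub, hcG, sub_self]
  by_contra hne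
  have hv : (v : Fin n → R) ≠ 0 := fun h => hne (sub_eq_zero.1 h)
  have hli : LinearIndependent R (Fin.cons v (fun i => ⟨E i, hE i⟩) : Fin (r + 1) → N) := by
    rw [Fintype.linearIndependent_iff]
    intro g hg
    have hg' : g 0 • (v : Fin n → R) + (fun i : Fin r => g i.succ) ᵥ* E = 0 := by
      have := congrArg Subtype.val hg
      rw [Fin.sum_univ_succ] at this
      simpa [vecMul_eq_sum] using this
    have hβ : (fun i : Fin r => g i.succ) = 0 := by
      refine eq_zero_of_vecMul_eq_zero hJ ?_
      have h2 : g 0 • ((v : Fin n → R) ∘ J) + ((fun i : Fin r => g i.succ) ᵥ* E) ∘ J = 0 :=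
        congrArg (fun f : Fin n → R => f ∘ J) hg'
      rwa [hvJ, smul_zero, zero_add, hsub] at h2
    rw [hβ, zero_vecMul, add_zero] at hg'
    exact Fin.cases ((smul_eq_zero.1 hg').resolve_right hv) (fun i => congrFun hβ i)
  have := Nat.cast_le.1 ((Module.le_rank_iff.2 ⟨_, hli⟩).trans hN)
  omega

theorem associated_of_prime_pow_dvd_iff {R : Type*} [CommRing R] [IsDomain R]
    [UniqueFactorizationMonoid R] {a b : R} (ha : a ≠ 0) (hb : b ≠ 0)
    (h : ∀ p : R, Prime p → ∀ k : ℕ, p ^ k ∣ a ↔ p ^ k ∣ b) : Associated a b :=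
  associated_of_dvd_dvd
    ((UniqueFactorizationMonoid.dvd_iff_emultiplicity_le ha).2 fun p hp =>
      emultiplicity_le_emultiplicity_iff.2 fun k => (h p hp k).1)
    ((UniqueFactorizationMonoid.dvd_iff_emultiplicity_le hb).2 fun p hp =>
      emultiplicity_le_emultiplicity_iff.2 fun k => (h p hp k).2)

theorem LinearMap.map_vecMul_eq_sum {R M : Type*} [CommRing R] [AddCommGroup M] [Module R M]
    {r n : ℕ} (π : (Fin n → R) →ₗ[R] M) (E : Matrix (Fin r) (Fin n) R) (c : Fin r → R) :
    π (c ᵥ* E) = ∑ j, c j • π (E j) := by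
  simp [vecMul_eq_sum, map_sum]

theorem IsGCDOf.dvd_iff {R : Type} [CommRing R] {g c : R} {S : Set R} (h : IsGCDOf g S) :
    c ∣ g ↔ ∀ a ∈ S, c ∣ a :=
  ⟨fun hc a ha => hc.trans (h.1 a ha), h.2 c⟩

theorem IsPresentation.dvd_det_of_dvd_minors {R : Type} [CommRing R] {m n k : ℕ} {M : Type}
    [AddCommGroup M] [Module R M] {A : Matrix (Fin m) (Fin n) R} {π : (Fin n → R) →ₗ[R] M}
    (hA : IsPresentation A π) {c : R} (hc : ∀ a ∈ minorsSet k A, c ∣ a)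
    (Q : Matrix (Fin k) (Fin n) R) (hQ : ∀ i, π (Q i) = 0) (J : Fin k → Fin n) :
    c ∣ (Q.submatrix id J).det := by
  refine dvd_det_of_mem_range_vecMulLinear (A.submatrix id J) (fun s => hc _ ⟨(s, J), rfl⟩) _
    fun i => ?_
  have hi : Q i ∈ LinearMap.range A.vecMulLinear := hA.2 ▸ LinearMap.mem_ker.2 (hQ i)
  obtain ⟨Y, hY⟩ := hi
  exact ⟨Y, congrArg (fun f : Fin n → R => f ∘ J) hY⟩

theorem IsPresentation.apply_row {R : Type} [CommRing R] {m n : ℕ} {M : Type}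
    [AddCommGroup M] [Module R M] {A : Matrix (Fin m) (Fin n) R} {π : (Fin n → R) →ₗ[R] M}
    (hA : IsPresentation A π) (i : Fin m) : π (A i) = 0 := by
  rw [← LinearMap.mem_ker, hA.2]
  exact ⟨Pi.single i 1, by simp [Matrix.row]⟩

/-- The rank of the kernel of a surjection from `R ^ n` onto the torsion-free quotient of `M`. -/
theorem rank_comap_torsion {R : Type} [CommRing R] [IsDomain R] {M : Type} [AddCommGroup M]
    [Module R M] {d n : ℕ} (hd : (d : Cardinal) = Module.rank R M)
    {π : (Fin n → R) →ₗ[R] M} (hπ : Function.Surjective π) :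
    Module.rank R ((Submodule.torsion R M).comap π) = (n - d : ℕ) := by
  have hker : LinearMap.ker ((Submodule.torsion R M).mkQ ∘ₗ π) =
      (Submodule.torsion R M).comap π := by
    rw [LinearMap.ker_comp, Submodule.ker_mkQ]
  have hsurj : Function.Surjective ((Submodule.torsion R M).mkQ ∘ₗ π) :=
    (Submodule.mkQ_surjective _).comp hπ
  have hq := (LinearMap.quotKerEquivOfSurjective _ hsurj).rank_eq
  rw [rank_quotient_eq_of_le_torsion le_rfl, ← hd] at hq
  have hsum := rank_quotient_add_rank_of_isDomain (LinearMap.ker ((Submodule.torsion R M).mkQ ∘ₗ π))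
  rw [hq, rank_fin_fun, hker] at hsum
  obtain ⟨k, hk⟩ := Cardinal.lt_aleph0.1
    ((le_add_self.trans_eq hsum).trans_lt (Cardinal.natCast_lt_aleph0 (n := n)))
  rw [hk] at hsum ⊢
  norm_cast at hsum ⊢
  omega

/-- Let `R` be a Noetherian UFD with fraction field `K`, and `M` a finitely
generated `R`-module with `d = dim_K (M ⊗_R K)`. Then `Δ_d(M) = Δ₀(tM)` up to units:
for any presentation matrix `A` (of size `m × n`) of `M` and any presentation matrix `B`
of the torsion submodule `tM`, the gcd of the `(n−d) × (n−d)` minors of `A` is associated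
to the gcd of the maximal minors of `B`. -/
theorem delta_d_eq_delta_zero_torsion {R : Type} [CommRing R] [IsDomain R]
    [IsNoetherianRing R] [UniqueFactorizationMonoid R]
    {M : Type} [AddCommGroup M] [Module R M] [Module.Finite R M]
    (d : ℕ)
    (hd : (d : Cardinal) = Module.rank (FractionRing R) (FractionRing R ⊗[R] M))
    {m n mB nB : ℕ}
    (A : Matrix (Fin m) (Fin n) R) (π : (Fin n → R) →ₗ[R] M)
    (hA : IsPresentation A π)
    (B : Matrix (Fin mB) (Fin nB) R)
    (πB : (Fin nB → R) →ₗ[R] (Submodule.torsion R M))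
    (hB : IsPresentation B πB)
    (dA dB : R)
    (hdA : IsGCDOf dA (minorsSet (n - d) A)) (hdB : IsGCDOf dB (minorsSet nB B)) :
    Associated dA dB := by
  set r := n - d
  have hrank : (d : Cardinal) = Module.rank R M :=
    hd.trans (IsBaseChange.rank_eq (TensorProduct.isBaseChange R M (FractionRing R)))
  set N := (Submodule.torsion R M).comap π with hNdef
  have hN : Module.rank R N = (r : ℕ) := rank_comap_torsion hrank hA.1
  have hsat : ∀ (a : R) (w : Fin n → R), a ≠ 0 → a • w ∈ N → w ∈ N := by
    intro a w ha hw
    obtain ⟨b, hb⟩ := (Submodule.mem_torsion_iff _).1 hw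
    refine (Submodule.mem_torsion_iff _).2
      ⟨⟨b * a, mul_mem b.2 (mem_nonZeroDivisors_of_ne_zero ha)⟩, ?_⟩
    rw [Submonoid.smul_def] at hb ⊢
    rwa [map_smul, smul_smul] at hb
  obtain ⟨e, he⟩ := Module.le_rank_iff.1 hN.ge
  let E₀ : Matrix (Fin r) (Fin n) R := fun i => e i
  have hE₀ : ∀ i, E₀ i ∈ N := fun i => (e i).2
  obtain ⟨J₀, hJ₀⟩ := exists_minor_ne_zero_of_linearIndependent E₀
    (he.map' N.subtype (Submodule.ker_subtype N))
  have hB' : ∀ v : Fin nB → R, (πB v : M) = ∑ j, v j • (πB (Pi.single j 1) : M) := fun v => by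
    conv_lhs => rw [pi_eq_sum_univ' v]
    simp [map_sum]
  have hBdvd : ∀ c : R, c ∣ dB → ∀ Q : Matrix (Fin nB) (Fin nB) R,
      (∀ i, ∑ j, Q i j • (πB (Pi.single j 1) : M) = 0) → c ∣ Q.det := fun c hc Q hQ =>
    hB.dvd_det_of_dvd_minors (hdB.dvd_iff.1 hc) Q
      (fun i => Subtype.ext ((hB' _).trans (hQ i))) id
  have hAdvd : ∀ (c : R), c ∣ dA → ∀ (E : Matrix (Fin r) (Fin n) R) (J : Fin r → Fin n)
      (Q : Matrix (Fin r) (Fin r) R), (∀ i, ∑ j, Q i j • π (E j) = 0) →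
      c ∣ Q.det * (E.submatrix id J).det := fun c hc E J Q hQ => by
    have := hA.dvd_det_of_dvd_minors (hdA.dvd_iff.1 hc) (Q * E) (fun i => by
      rw [mul_apply_eq_vecMul, π.map_vecMul_eq_sum, hQ]) J
    rwa [submatrix_mul Q E id id J Function.bijective_id, submatrix_id_id, det_mul] at this
  have hann : ∀ {k : ℕ} (x : Fin k → M), (∀ i, x i ∈ Submodule.torsion R M) →
      ∃ Q : Matrix (Fin k) (Fin k) R, Q.det ≠ 0 ∧ ∀ i, ∑ j, Q i j • x j = 0 := by
    intro k x hx
    choose a ha using fun i => (Submodule.mem_torsion_iff _).1 (hx i)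
    refine ⟨diagonal fun i => (a i : R), ?_, fun i => ?_⟩
    · rw [det_diagonal, Finset.prod_ne_zero_iff]
      exact fun i _ => nonZeroDivisors.ne_zero (a i).2
    · simpa [diagonal_apply, Submonoid.smul_def] using ha i
  refine associated_of_prime_pow_dvd_iff ?_ ?_ fun p hp k => ?_
  · rintro rfl
    obtain ⟨Q, hQ, hQE⟩ := hann (fun i => π (E₀ i)) hE₀
    exact mul_ne_zero hQ hJ₀ (zero_dvd_iff.1 (hAdvd 0 dvd_rfl E₀ J₀ Q hQE))
  · rintro rfl
    obtain ⟨Q, hQ, hQy⟩ := hann (fun j => (πB (Pi.single j 1) : M)) fun j => (πB _).2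
    exact hQ (zero_dvd_iff.1 (hBdvd 0 dvd_rfl Q hQy))
  obtain ⟨E, J, hE, hJ⟩ := exists_minor_not_dvd_of_saturated hsat hE₀ hJ₀ hp
  have hJ0 : (E.submatrix id J).det ≠ 0 := fun h => hJ (h ▸ dvd_zero p)
  have hcramer : ∀ w ∈ N, ∃ c : Fin r → R, (E.submatrix id J).det • w = c ᵥ* E :=
    fun w hw => exists_det_smul_eq_vecMul hN.le hE hJ0 hw
  set δ := (E.submatrix id J).det
  have hδpow : ∀ l, ¬ p ∣ δ ^ l := fun l h => hJ (hp.dvd_of_dvd_pow h)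
  have hU : ∃ U : Matrix (Fin r) (Fin nB) R,
      ∀ i, (1 : R) • π (E i) = ∑ j, U i j • (πB (Pi.single j 1) : M) := by
    choose u hu using fun i => hB.1 ⟨π (E i), hE i⟩
    exact ⟨u, fun i => by rw [one_smul, ← hB', hu]⟩
  have hV : ∃ V : Matrix (Fin nB) (Fin r) R,
      ∀ i, δ • (πB (Pi.single i 1) : M) = ∑ j, V i j • π (E j) := by
    choose w hw using fun i => hA.1 (πB (Pi.single i 1) : M)
    choose V hV using fun i => hcramer (w i) (show π (w i) ∈ _ from hw i ▸ (πB _).2)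
    exact ⟨V, fun i => by rw [← π.map_vecMul_eq_sum, ← hV, map_smul, hw]⟩
  obtain ⟨U, hU⟩ := hU
  obtain ⟨V, hV⟩ := hV
  constructor
  · intro hk
    refine hdB.dvd_iff.2 ?_
    rintro _ ⟨⟨s, t⟩, rfl⟩
    have hBs := dvd_det_of_relations hV hU
      (fun Q hQ => hp.pow_dvd_of_dvd_mul_right k hJ (hAdvd _ hk E J Q hQ)) (B.submatrix s id)
      fun i => by
        rw [← hB']
        exact congrArg Subtype.val (hB.apply_row (s i))
    rw [one_mul] at hBs
    have hst : B.submatrix s t =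
        B.submatrix s id * (1 : Matrix (Fin nB) (Fin nB) R).submatrix id t := by
      ext i j
      simp [mul_apply, one_apply]
    change p ^ k ∣ (B.submatrix s t).det
    rw [hst, det_mul]
    exact Dvd.dvd.mul_right (hp.pow_dvd_of_dvd_mul_left k (hδpow _) hBs) _
  · intro hk
    refine hdA.dvd_iff.2 ?_
    rintro _ ⟨⟨s, t⟩, rfl⟩
    choose X hX using fun i => hcramer (A (s i)) (by
      rw [hNdef, Submodule.mem_comap, hA.apply_row]; exact zero_mem _)
    have hXdvd := dvd_det_of_relations hU hV (hBdvd _ hk) X fun i => by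
      rw [← π.map_vecMul_eq_sum, ← hX, map_smul, hA.apply_row, smul_zero]
    rw [mul_one] at hXdvd
    have hX' := hp.pow_dvd_of_dvd_mul_left k (hδpow _) hXdvd
    refine hp.pow_dvd_of_dvd_mul_left k (hδpow r) ?_
    have hmul : δ • A.submatrix s t = of X * E.submatrix id t := by
      ext i j
      exact congrFun (hX i) (t j)
    have hdet := congrArg det hmul
    rw [det_smul, det_mul, Fintype.card_fin] at hdet
    change p ^ k ∣ δ ^ r * (A.submatrix s t).det
    rw [hdet]
    exact Dvd.dvd.mul_right hX' _
end
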